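/- Let N ≥ 2, l > 0, and let i, j ∈ Fin N with i ≠ j. There exist constants K > 0 and δ₀ > 0 such that for every function ψ : (Fin N → ℝ) → ℂ that is continuously differentiable on the closed box B = [0, l]^N and every δ with 0 < δ ≤ δ₀, one has (1/l) ∫_B |ψ(update(x, j, xᵢ))|² dx ≤ K ( (2/δ) ∫_B |ψ(x)|² dx + δ ∫_B Σ_{k} |∂_kψ(x)|² dx ). -/

import Mathlib

open MeasureTheory

/-- A squared norm at a point of `[0, l]` is bounded by the `H¹` data of the function. -/
lemma norm_sq_le_of_hasDerivWithinAt {E : Type*} [NormedAddCommGroup E]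
    [InnerProductSpace ℝ E] {l δ : ℝ} (hl : 0 < l) (hδ : 0 < δ) (hδl : δ ≤ l)
    {f f' : ℝ → E} (hf : ∀ s ∈ Set.Icc 0 l, HasDerivWithinAt f (f' s) (Set.Icc 0 l) s)
    (hf' : ContinuousOn f' (Set.Icc 0 l)) {t : ℝ} (ht : t ∈ Set.Icc 0 l) :
    ‖f t‖ ^ 2 ≤ ∫ s in Set.Icc 0 l, (2 / δ * ‖f s‖ ^ 2 + δ * ‖f' s‖ ^ 2) := by
  have hfc : ContinuousOn f (Set.Icc 0 l) := fun s hs => (hf s hs).continuousWithinAt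
  set h : ℝ → ℝ := fun s => 1 / δ * ‖f s‖ ^ 2 + δ * ‖f' s‖ ^ 2 with hh
  have hu : ContinuousOn (fun s => ‖f s‖ ^ 2) (Set.Icc 0 l) := hfc.norm.pow 2
  have hhc : ContinuousOn h (Set.Icc 0 l) :=
    (continuousOn_const.mul hu).add (continuousOn_const.mul (hf'.norm.pow 2))
  have hu' : ContinuousOn (fun s => 2 * inner ℝ (f s) (f' s)) (Set.Icc 0 l) :=
    continuousOn_const.mul (hfc.inner hf')
  have hui : IntegrableOn (fun s => ‖f s‖ ^ 2) (Set.Icc 0 l) :=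
    hu.integrableOn_compact isCompact_Icc
  have hhi : IntegrableOn h (Set.Icc 0 l) := hhc.integrableOn_compact isCompact_Icc
  have hbound : ∀ s, |2 * inner ℝ (f s) (f' s)| ≤ h s := by
    intro s
    have h1 := abs_real_inner_le_norm (f s) (f' s)
    have h2 : h s - 2 * (‖f s‖ * ‖f' s‖) = (1 / δ) * (‖f s‖ - δ * ‖f' s‖) ^ 2 := by
      simp only [hh]; field_simp; ring
    have h3 : 0 ≤ (1 / δ) * (‖f s‖ - δ * ‖f' s‖) ^ 2 := by positivity
    rw [abs_mul, abs_two]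
    linarith
  have hosc : ∀ a ∈ Set.Icc 0 l, ∀ b ∈ Set.Icc 0 l, a ≤ b →
      |‖f b‖ ^ 2 - ‖f a‖ ^ 2| ≤ ∫ s in Set.Icc 0 l, h s := by
    intro a ha b hb hab
    have hsub : Set.Icc a b ⊆ Set.Icc 0 l := Set.Icc_subset_Icc ha.1 hb.2
    have hftc : ∫ s in a..b, 2 * inner ℝ (f s) (f' s) = ‖f b‖ ^ 2 - ‖f a‖ ^ 2 := by
      refine intervalIntegral.integral_eq_sub_of_hasDerivAt_of_le hab (hu.mono hsub) ?_
        ((hu'.mono hsub).intervalIntegrable_of_Icc hab)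
      intro s hs
      have hs' : s ∈ Set.Ioo 0 l := ⟨ha.1.trans_lt hs.1, hs.2.trans_le hb.2⟩
      exact ((hf s (Set.Ioo_subset_Icc_self hs')).hasDerivAt
        (Icc_mem_nhds hs'.1 hs'.2)).norm_sq
    rw [← hftc]
    calc |∫ s in a..b, 2 * inner ℝ (f s) (f' s)|
        ≤ ∫ s in a..b, |2 * inner ℝ (f s) (f' s)| :=
          intervalIntegral.abs_integral_le_integral_abs hab
      _ ≤ ∫ s in a..b, h s := by
          refine intervalIntegral.integral_mono_on hab
            ((hu'.mono hsub).abs.intervalIntegrable_of_Icc hab)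
            ((hhc.mono hsub).intervalIntegrable_of_Icc hab) fun s _ => hbound s
      _ = ∫ s in Set.Icc a b, h s := by
          rw [intervalIntegral.integral_of_le hab, integral_Icc_eq_integral_Ioc]
      _ ≤ ∫ s in Set.Icc 0 l, h s :=
          setIntegral_mono_set hhi (Filter.Eventually.of_forall fun s => by
            simp only [hh, Pi.zero_apply]; positivity) hsub.eventuallyLE
  obtain ⟨s, hs, hmin⟩ := isCompact_Icc.exists_isMinOn ⟨t, ht⟩ hu
  have hst : ‖f t‖ ^ 2 ≤ ‖f s‖ ^ 2 + ∫ s in Set.Icc 0 l, h s := by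
    rcases le_total s t with hle | hle
    · linarith [(abs_le.1 (hosc s hs t ht hle)).2]
    · linarith [(abs_le.1 (hosc t ht s hs hle)).1]
  have havg : l * ‖f s‖ ^ 2 ≤ ∫ r in Set.Icc 0 l, ‖f r‖ ^ 2 := by
    have := setIntegral_mono_on (μ := volume) (s := Set.Icc 0 l)
      (f := fun _ => ‖f s‖ ^ 2) (by simp) hui measurableSet_Icc fun r hr => hmin hr
    simpa [hl.le] using this
  have hnn : 0 ≤ ∫ r in Set.Icc 0 l, ‖f r‖ ^ 2 := integral_nonneg fun _ => by positivity
  have hs1 : ‖f s‖ ^ 2 ≤ 1 / δ * ∫ r in Set.Icc 0 l, ‖f r‖ ^ 2 := by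
    have : δ * ‖f s‖ ^ 2 ≤ ∫ r in Set.Icc 0 l, ‖f r‖ ^ 2 :=
      (mul_le_mul_of_nonneg_right hδl (by positivity)).trans havg
    rw [one_div, ← div_eq_inv_mul, le_div_iff₀ hδ]
    linarith
  have hsplit : ∫ s in Set.Icc 0 l, (2 / δ * ‖f s‖ ^ 2 + δ * ‖f' s‖ ^ 2)
      = 1 / δ * (∫ r in Set.Icc 0 l, ‖f r‖ ^ 2) + ∫ s in Set.Icc 0 l, h s := by
    rw [← integral_const_mul, ← integral_add (hui.const_mul _) hhi]
    congr 1
    ext s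
    simp only [hh]
    ring
  linarith

/-- Averaging a function over one coordinate does not change its integral, up to the total mass
of the factor. -/
lemma lintegral_lintegral_update {ι : Type*} [Fintype ι] [DecidableEq ι] {X : ι → Type*}
    [∀ i, MeasurableSpace (X i)] (μ : ∀ i, Measure (X i)) [∀ i, SigmaFinite (μ i)]
    (j : ι) {F : (∀ i, X i) → ENNReal} (hF : Measurable F) :
    ∫⁻ x, ∫⁻ s, F (Function.update x j s) ∂μ j ∂Measure.pi μ
      = μ j Set.univ * ∫⁻ x, F x ∂Measure.pi μ := by
  rcases isEmpty_or_nonempty (∀ i, X i) with he | ⟨⟨x₀⟩⟩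
  · simp [Measure.eq_zero_of_isEmpty]
  have hG : Measurable fun x => ∫⁻ s, F (Function.update x j s) ∂μ j := by
    have := hF.lmarginal μ (s := {j})
    rwa [lmarginal_singleton] at this
  rw [lintegral_eq_lmarginal_univ x₀, lintegral_eq_lmarginal_univ x₀,
    lmarginal_erase' F hF (Finset.mem_univ j), lmarginal_erase' _ hG (Finset.mem_univ j)]
  simp only [Function.update_idem, lintegral_const]
  simp only [lmarginal]
  rw [lintegral_mul_const, mul_comm]
  exact hG.comp measurable_updateFinset

/-- A function on a box that is dominated by its line integrals in direction `j` has integral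
dominated by the corresponding volume integral. -/
lemma setIntegral_Icc_le_mul_of_le_integral_update {ι : Type*} [Fintype ι] [DecidableEq ι]
    {l : ℝ} (hl : 0 ≤ l) (j : ι) {v G : (ι → ℝ) → ℝ}
    (hG : ContinuousOn G (Set.Icc 0 fun _ => l)) (hG0 : ∀ x, 0 ≤ G x)
    (hv : ContinuousOn v (Set.Icc 0 fun _ => l)) (hv0 : ∀ x, 0 ≤ v x)
    (hvG : ∀ x ∈ Set.Icc (0 : ι → ℝ) (fun _ => l),
      v x ≤ ∫ s in Set.Icc 0 l, G (Function.update x j s)) :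
    ∫ x in Set.Icc (0 : ι → ℝ) (fun _ => l), v x
      ≤ l * ∫ x in Set.Icc (0 : ι → ℝ) (fun _ => l), G x := by
  set B : Set (ι → ℝ) := Set.Icc 0 fun _ => l with hB
  have hBm : MeasurableSet B := measurableSet_Icc
  have hBpi : B = Set.univ.pi fun _ => Set.Icc (0 : ℝ) l := by
    rw [Set.pi_univ_Icc]; rfl
  have hmu : ∀ x ∈ B, ∀ s ∈ Set.Icc 0 l, Function.update x j s ∈ B := by
    intro x hx s hs
    rw [hBpi] at hx ⊢
    exact Set.update_mem_pi_iff_of_mem hx |>.2 fun _ => hs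
  set F : (ι → ℝ) → ENNReal := B.indicator fun x => ENNReal.ofReal (G x) with hF
  have hFm : Measurable F := by
    classical
    have := (ENNReal.continuous_ofReal.comp_continuousOn hG).measurable_piecewise
      (continuousOn_const (c := (0 : ENNReal))) hBm
    convert this using 1
    exact (Set.piecewise_eq_indicator (f := ENNReal.ofReal ∘ G)).symm
  have hrestrict : (volume : Measure (ι → ℝ)).restrict B
      = Measure.pi fun _ => (volume : Measure ℝ).restrict (Set.Icc 0 l) := by
    rw [hBpi, volume_pi, Measure.restrict_pi_pi]
  have hGi : IntegrableOn G B := hG.integrableOn_compact isCompact_Icc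
  have hvi : IntegrableOn v B := hv.integrableOn_compact isCompact_Icc
  have key : ∫⁻ x in B, ENNReal.ofReal (v x)
      ≤ ENNReal.ofReal l * ∫⁻ x in B, ENNReal.ofReal (G x) := by
    calc ∫⁻ x in B, ENNReal.ofReal (v x)
        ≤ ∫⁻ x in B, ∫⁻ s in Set.Icc 0 l, F (Function.update x j s) := by
          refine setLIntegral_mono' hBm fun x hx => ?_
          have hc : ContinuousOn (fun s => G (Function.update x j s)) (Set.Icc 0 l) :=
            hG.comp (by fun_prop) fun s hs => hmu x hx s hs
          have heq : ∫⁻ s in Set.Icc 0 l, F (Function.update x j s)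
              = ∫⁻ s in Set.Icc 0 l, ENNReal.ofReal (G (Function.update x j s)) :=
            setLIntegral_congr_fun measurableSet_Icc fun s hs => by
              simp only [hF, Set.indicator_of_mem (hmu x hx s hs)]
          rw [heq, ← ofReal_integral_eq_lintegral_ofReal
            (hc.integrableOn_compact isCompact_Icc) (Filter.Eventually.of_forall fun s => hG0 _)]
          exact ENNReal.ofReal_le_ofReal (hvG x hx)
      _ = ENNReal.ofReal l * ∫⁻ x in B, F x := by
          rw [hrestrict, lintegral_lintegral_update _ j hFm]
          simp
      _ = ENNReal.ofReal l * ∫⁻ x in B, ENNReal.ofReal (G x) := by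
          congr 1
          exact setLIntegral_congr_fun hBm fun x hx => by
            simp only [hF, Set.indicator_of_mem hx]
  rw [← ofReal_integral_eq_lintegral_ofReal hvi (Filter.Eventually.of_forall hv0),
    ← ofReal_integral_eq_lintegral_ofReal hGi (Filter.Eventually.of_forall hG0),
    ← ENNReal.ofReal_mul hl] at key
  exact (ENNReal.ofReal_le_ofReal_iff
    (mul_nonneg hl (integral_nonneg hG0))).1 key

/-- Hyperplane trace estimate in the box `[0, l]^N`: for `i ≠ j` there are
constants `K > 0` and `δ₀ > 0` such that for every `ψ` continuously differentiable
on the box and every `0 < δ ≤ δ₀`, the integral of `|ψ|²` over the coincidence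
hyperplane `{x_j = x_i}` (written as `(1/l) ∫_B |ψ(update(x, j, xᵢ))|² dx`) is
controlled by the `H¹`-type data of `ψ`. -/
theorem coincidence_hyperplane_trace_estimate (N : ℕ) (hN : 2 ≤ N) (l : ℝ)
    (hl : 0 < l) (i j : Fin N) (hij : i ≠ j) :
    ∃ K > (0:ℝ), ∃ δ₀ > (0:ℝ), ∀ ψ : (Fin N → ℝ) → ℂ,
      ContDiffOn ℝ 1 ψ (Set.Icc (0 : Fin N → ℝ) (fun _ => l)) →
      ∀ δ : ℝ, 0 < δ → δ ≤ δ₀ →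
      (1 / l) * (∫ x in Set.Icc (0 : Fin N → ℝ) (fun _ => l),
          ‖ψ (Function.update x j (x i))‖ ^ 2)
        ≤ K * ((2 / δ) * (∫ x in Set.Icc (0 : Fin N → ℝ) (fun _ => l), ‖ψ x‖ ^ 2)
          + δ * (∫ x in Set.Icc (0 : Fin N → ℝ) (fun _ => l),
              ∑ k : Fin N, ‖fderiv ℝ ψ x (Pi.single k 1)‖ ^ 2)) := by
  refine ⟨1, one_pos, l, hl, fun ψ hψ δ hδ hδl => ?_⟩
  set B : Set (Fin N → ℝ) := Set.Icc 0 fun _ => l with hB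
  have hBpi : B = Set.univ.pi fun _ => Set.Icc (0 : ℝ) l := by
    rw [Set.pi_univ_Icc]; rfl
  have hmu : ∀ x ∈ B, ∀ s ∈ Set.Icc 0 l, Function.update x j s ∈ B := by
    intro x hx s hs
    rw [hBpi] at hx ⊢
    exact Set.update_mem_pi_iff_of_mem hx |>.2 fun _ => hs
  have hconv : Convex ℝ B := convex_Icc _ _
  have hint : (interior B).Nonempty := by
    rw [hBpi, interior_pi_set Set.finite_univ]
    exact Set.univ_pi_nonempty_iff.2 fun _ => by simpa using hl
  have hud : UniqueDiffOn ℝ B := uniqueDiffOn_convex hconv hint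
  have hψc : ContinuousOn ψ B := hψ.continuousOn
  set D := fderivWithin ℝ ψ B with hD
  have hDc : ContinuousOn D B := hψ.continuousOn_fderivWithin hud le_rfl
  have hDk : ∀ k, ContinuousOn (fun x => D x (Pi.single k 1)) B := fun k =>
    hDc.clm_apply continuousOn_const
  have hψ2 : ContinuousOn (fun x => ‖ψ x‖ ^ 2) B := hψc.norm.pow 2
  have hD2 : ContinuousOn (fun x => ∑ k, ‖D x (Pi.single k 1)‖ ^ 2) B :=
    continuousOn_finsetSum _ fun k _ => (hDk k).norm.pow 2
  have hae : ∫ x in B, ∑ k, ‖fderiv ℝ ψ x (Pi.single k 1)‖ ^ 2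
      = ∫ x in B, ∑ k, ‖D x (Pi.single k 1)‖ ^ 2 := by
    have hfr : (volume : Measure (Fin N → ℝ)) (frontier B) = 0 := hconv.addHaar_frontier volume
    refine setIntegral_congr_ae measurableSet_Icc ?_
    filter_upwards [measure_eq_zero_iff_ae_notMem.1 hfr] with x hx hxB
    have hxi : x ∈ interior B := by
      by_contra hn
      exact hx ⟨subset_closure hxB, hn⟩
    rw [hD, fderivWithin_of_mem_nhds (mem_interior_iff_mem_nhds.1 hxi)]
  have hmain : ∫ x in B, ‖ψ (Function.update x j (x i))‖ ^ 2
      ≤ l * ∫ x in B, (2 / δ * ‖ψ x‖ ^ 2 + δ * ∑ k, ‖D x (Pi.single k 1)‖ ^ 2) := by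
    have hcoord : ∀ x ∈ B, x i ∈ Set.Icc 0 l := fun x hx => ⟨hx.1 i, hx.2 i⟩
    have hGc : ContinuousOn
        (fun x => 2 / δ * ‖ψ x‖ ^ 2 + δ * ∑ k, ‖D x (Pi.single k 1)‖ ^ 2) B :=
      (continuousOn_const.mul hψ2).add (continuousOn_const.mul hD2)
    refine setIntegral_Icc_le_mul_of_le_integral_update hl.le j hGc
      (fun x => by positivity) ?_ (fun x => by positivity) fun x hx => ?_
    · exact hψ2.comp (by fun_prop) fun x hx => hmu x hx _ (hcoord x hx)
    · have hupd : ContinuousOn (Function.update x j) (Set.Icc 0 l) := by fun_prop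
      have hmaps : Set.MapsTo (Function.update x j) (Set.Icc 0 l) B := hmu x hx
      have hj : ContinuousOn (fun s => D (Function.update x j s) (Pi.single j 1))
          (Set.Icc 0 l) := (hDk j).comp hupd hmaps
      refine (norm_sq_le_of_hasDerivWithinAt (f := fun s => ψ (Function.update x j s))
        hl hδ hδl (fun s hs => ?_) hj (hcoord x hx)).trans ?_
      · exact ((hψ.differentiableOn one_ne_zero _ (hmaps hs)).hasFDerivWithinAt).comp_hasDerivWithinAt
          s (hasDerivAt_update x j s).hasDerivWithinAt hmaps
      · refine setIntegral_mono_on ?_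
          ((hGc.comp hupd hmaps).integrableOn_compact isCompact_Icc) measurableSet_Icc
          fun s _ => ?_
        · exact ((continuousOn_const.mul (hψ2.comp hupd hmaps)).add
            (continuousOn_const.mul (hj.norm.pow 2))).integrableOn_compact isCompact_Icc
        · gcongr
          exact Finset.single_le_sum
            (f := fun k => ‖D (Function.update x j s) (Pi.single k 1)‖ ^ 2)
            (fun k _ => by positivity) (Finset.mem_univ j)
  rw [hae, one_mul, one_div, inv_mul_le_iff₀ hl, ← integral_const_mul, ← integral_const_mul,
    ← integral_add ((hψ2.integrableOn_compact isCompact_Icc).const_mul _)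
      ((hD2.integrableOn_compact isCompact_Icc).const_mul _)]
  exact hmain
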